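/- Let n ≥ 3 and fix radii 0 < μ < 1 < λ < μ'. There exists a constant C > 0 such that for every R > 0 and every continuously differentiable map X : {x : μR < ‖x‖ < μ'R} → ℝ^n that is integrable on that annulus and satisfies ∂X_i/∂x_j = ∂X_j/∂x_i there, there is a continuously differentiable function u on the annulus A_R = {x : R < ‖x‖ < λR} with ∇u = X on A_R and ‖u‖_{L^1(A_R)} ≤ C · R · ‖X‖_{L^1({μR < ‖x‖ < μ'R})}. The constant C does not depend on R. -/

import Mathlib

open MeasureTheory

section Primitive

variable {E P : Type*} [NormedAddCommGroup E] [NormedSpace ℝ E]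
  [NormedAddCommGroup P] [NormedSpace ℝ P]

theorem exists_primitive_pullback {F : P → E} (hF : ContDiff ℝ 2 F) {Ω : Set P}
    (hΩ : IsOpen Ω) (hconv : Convex ℝ Ω) {U : Set E} (hU : IsOpen U) (hFU : Set.MapsTo F Ω U)
    {ω : E → E →L[ℝ] ℝ} (hω : DifferentiableOn ℝ ω U)
    (hsymm : ∀ x ∈ U, ∀ a b, fderiv ℝ ω x a b = fderiv ℝ ω x b a) :
    ∃ w : P → ℝ, ∀ p ∈ Ω, HasFDerivAt w ((ω (F p)).comp (fderiv ℝ F p)) p := by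
  have key : ∀ p ∈ Ω, HasFDerivAt (fun p ↦ (ω (F p)).comp (fderiv ℝ F p))
      (((ContinuousLinearMap.compL ℝ P E ℝ) (ω (F p))).comp (fderiv ℝ (fderiv ℝ F) p) +
        ((ContinuousLinearMap.compL ℝ P E ℝ).flip (fderiv ℝ F p)).comp
          ((fderiv ℝ ω (F p)).comp (fderiv ℝ F p))) p := by
    intro p hp
    have h1 : HasFDerivAt F (fderiv ℝ F p) p :=
      (hF.differentiable (by norm_num) p).hasFDerivAt
    have h2 : HasFDerivAt (fderiv ℝ F) (fderiv ℝ (fderiv ℝ F) p) p :=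
      ((hF.fderiv_right (m := 1) (by norm_num)).differentiable (by norm_num) p).hasFDerivAt
    have h3 : HasFDerivAt ω (fderiv ℝ ω (F p)) (F p) :=
      (hω.differentiableAt (hU.mem_nhds (hFU hp))).hasFDerivAt
    exact (h3.comp p h1).clm_comp h2
  refine hconv.exists_forall_hasFDerivAt_of_fderiv_symmetric hΩ
    (fun p hp ↦ (key p hp).differentiableAt.differentiableWithinAt) fun p hp a b ↦ ?_
  rw [(key p hp).fderiv]
  have hs : IsSymmSndFDerivAt ℝ F p := hF.contDiffAt.isSymmSndFDerivAt (by simp)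
  simp [hs.eq a b, hsymm (F p) (hFU hp) (fderiv ℝ F p a) (fderiv ℝ F p b)]

theorem hasFDerivAt_primitive_of_leftInverse {F : P → E} {w : P → ℝ} {ω : E → E →L[ℝ] ℝ}
    {G : E → P} {x : E} (hG : DifferentiableAt ℝ G x) (hF : DifferentiableAt ℝ F (G x))
    (hFG : ∀ᶠ y in nhds x, F (G y) = y)
    (hw : HasFDerivAt w ((ω (F (G x))).comp (fderiv ℝ F (G x))) (G x)) :
    HasFDerivAt (w ∘ G) (ω x) x := by
  have h1 := hw.comp x hG.hasFDerivAt
  have h2 : HasFDerivAt (F ∘ G) ((fderiv ℝ F (G x)).comp (fderiv ℝ G x)) x :=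
    hF.hasFDerivAt.comp x hG.hasFDerivAt
  have h3 : (fderiv ℝ F (G x)).comp (fderiv ℝ G x) = ContinuousLinearMap.id ℝ E :=
    h2.unique ((hasFDerivAt_id x).congr_of_eventuallyEq hFG)
  rw [ContinuousLinearMap.comp_assoc, h3, hFG.self_of_nhds] at h1
  simpa using h1

theorem exists_primitive_union {U V : Set E} (hU : IsOpen U) (hV : IsOpen V)
    (hUV : IsPreconnected (U ∩ V)) {ω : E → E →L[ℝ] ℝ}
    (h1 : ∃ u : E → ℝ, ∀ x ∈ U, HasFDerivAt u (ω x) x)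
    (h2 : ∃ u : E → ℝ, ∀ x ∈ V, HasFDerivAt u (ω x) x) :
    ∃ u : E → ℝ, ∀ x ∈ U ∪ V, HasFDerivAt u (ω x) x := by
  classical
  obtain ⟨f, hf⟩ := h1
  obtain ⟨g, hg⟩ := h2
  obtain ⟨a, ha⟩ := (hU.inter hV).exists_eq_add_of_fderiv_eq hUV (f := f) (g := g)
    (fun x hx ↦ (hf x hx.1).differentiableAt.differentiableWithinAt)
    (fun x hx ↦ (hg x hx.2).differentiableAt.differentiableWithinAt)
    (fun x hx ↦ (hf x hx.1).fderiv.trans (hg x hx.2).fderiv.symm)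
  refine ⟨U.piecewise f (g · + a), ?_⟩
  rintro x (hx | hx)
  · refine (hf x hx).congr_of_eventuallyEq ?_
    filter_upwards [hU.mem_nhds hx] with y hy
    simp [hy]
  · refine ((hg x hx).add_const a).congr_of_eventuallyEq ?_
    filter_upwards [hV.mem_nhds hx] with y hy
    by_cases hyU : y ∈ U
    · simpa [hyU] using ha ⟨hyU, hy⟩
    · simp [hyU]

end Primitive

section Shell

variable {E : Type*} [NormedAddCommGroup E] [InnerProductSpace ℝ E]

/-- The open spherical shell of inner radius `a` and outer radius `b`. -/
def openShell (E : Type*) [NormedAddCommGroup E] (a b : ℝ) : Set E :=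
  {x | a < ‖x‖ ∧ ‖x‖ < b}

omit [InnerProductSpace ℝ E] in
theorem isOpen_openShell (a b : ℝ) : IsOpen (openShell E a b) :=
  (isOpen_lt continuous_const continuous_norm).inter (isOpen_lt continuous_norm continuous_const)

theorem IsPreconnected.inter_openShell {T : Set E} (hT : IsPreconnected T)
    (h0 : (0 : E) ∉ T) (hcone : ∀ x ∈ T, ∀ s : ℝ, 0 < s → s • x ∈ T) {a b : ℝ} (ha : 0 ≤ a) :
    IsPreconnected (T ∩ openShell E a b) := by
  have hne : ∀ x ∈ T, ‖x‖ ≠ 0 := fun x hx h ↦ h0 (norm_eq_zero.1 h ▸ hx)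
  have himg : T ∩ openShell E a b =
      (fun p : E × ℝ ↦ (p.2 / ‖p.1‖) • p.1) '' (T ×ˢ Set.Ioo a b) := by
    ext x
    constructor
    · rintro ⟨hx, h1, h2⟩
      exact ⟨(x, ‖x‖), ⟨hx, h1, h2⟩, by simp [div_self (hne x hx)]⟩
    · rintro ⟨⟨y, s⟩, ⟨hy, hs1, hs2⟩, rfl⟩
      have hy' := hne y hy
      have hs : 0 < s := ha.trans_lt hs1
      refine ⟨hcone y hy _ (by positivity), ?_⟩
      have : ‖(s / ‖y‖) • y‖ = s := by
        rw [norm_smul, norm_div, norm_norm, div_mul_cancel₀ _ hy', Real.norm_of_nonneg hs.le]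
      simpa [openShell, this] using ⟨hs1, hs2⟩
  rw [himg]
  refine (hT.prod isPreconnected_Ioo).image _ ?_
  refine ContinuousOn.smul (continuousOn_snd.div continuousOn_fst.norm ?_) continuousOn_fst
  exact fun p hp ↦ hne _ hp.1

theorem isPreconnected_openShell (h : 1 < Module.rank ℝ E) {a b : ℝ} (ha : 0 ≤ a) :
    IsPreconnected (openShell E a b) := by
  have := (isConnected_compl_singleton_of_one_lt_rank h (0 : E)).isPreconnected.inter_openShell
    (by simp) (fun x hx s hs ↦ by simpa [hs.ne'] using hx) (b := b) ha
  rwa [Set.inter_eq_right.2] at this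
  rintro x hx rfl
  simp only [openShell, Set.mem_ofPred_eq, norm_zero] at hx
  linarith [hx.1]

theorem exists_primitive_openShell_inner_lt [FiniteDimensional ℝ E] {v : E} (hv : ‖v‖ = 1)
    {a b : ℝ} (ha : 0 ≤ a)
    {ω : E → E →L[ℝ] ℝ} (hω : DifferentiableOn ℝ ω (openShell E a b))
    (hsymm : ∀ x ∈ openShell E a b, ∀ y z, fderiv ℝ ω x y z = fderiv ℝ ω x z y) :
    ∃ u : E → ℝ, ∀ x ∈ openShell E a b ∩ {x | inner ℝ v x < ‖x‖}, HasFDerivAt u (ω x) x := by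
  let F : ℝ × (ℝ ∙ v)ᗮ → E := fun p ↦ p.1 • stereoInvFunAux v (p.2 : E)
  let G : E → ℝ × (ℝ ∙ v)ᗮ := fun x ↦ (‖x‖, stereoToFun v (‖x‖⁻¹ • x))
  have hF : ContDiff ℝ 2 F := contDiff_fst.smul
    (contDiff_stereoInvFunAux.comp ((ℝ ∙ v)ᗮ.subtypeL.contDiff.comp contDiff_snd))
  obtain ⟨w, hw⟩ := exists_primitive_pullback hF (Ω := Set.Ioo a b ×ˢ Set.univ)
    (isOpen_Ioo.prod isOpen_univ) ((convex_Ioo a b).prod convex_univ)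
    (isOpen_openShell a b) (fun p hp ↦ by
      have h1 : ‖stereoInvFunAux v (p.2 : E)‖ = 1 := by
        simpa using stereoInvFunAux_mem hv p.2.2
      have h2 : ‖F p‖ = p.1 := by
        simp only [F, norm_smul, h1, mul_one]
        exact Real.norm_of_nonneg (ha.trans hp.1.1.le)
      simpa [openShell, h2] using hp.1) hω hsymm
  refine ⟨w ∘ G, fun x hx ↦ ?_⟩
  have hopen : IsOpen (openShell E a b ∩ {x | inner ℝ v x < ‖x‖}) :=
    (isOpen_openShell a b).inter (isOpen_lt (by fun_prop) continuous_norm)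
  have hpos : ∀ y ∈ openShell E a b, 0 < ‖y‖ := fun y hy ↦ ha.trans_lt hy.1
  have hFG : ∀ y ∈ openShell E a b ∩ {x | inner ℝ v x < ‖x‖}, F (G y) = y := by
    intro y hy
    have h0 := hpos y hy.1
    have h1 : ‖‖y‖⁻¹ • y‖ = 1 := by simp [norm_smul, h0.ne']
    have h2 : ‖y‖⁻¹ • y ≠ v := by
      intro h
      have h3 : inner ℝ v y = ‖y‖ := by
        have : y = ‖y‖ • v := by rw [← h, smul_inv_smul₀ h0.ne']
        rw [this, inner_smul_right, real_inner_self_eq_norm_sq, hv, norm_smul, hv]; simp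
      exact hy.2.ne h3
    have h4 := congrArg Subtype.val
      (stereo_left_inv hv (x := ⟨‖y‖⁻¹ • y, by simpa using h1⟩) h2)
    change ‖y‖ • stereoInvFunAux v (stereoToFun v (‖y‖⁻¹ • y) : E) = y
    change stereoInvFunAux v (stereoToFun v (‖y‖⁻¹ • y) : E) = _ at h4
    rw [h4, smul_inv_smul₀ h0.ne']
  have hx0 : ‖x‖ ≠ 0 := (hpos x hx.1).ne'
  have hnorm : DifferentiableAt ℝ (fun y : E ↦ ‖y‖) x :=
    differentiableAt_id.norm ℝ (norm_ne_zero_iff.1 hx0)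
  have hst : DifferentiableAt ℝ (stereoToFun v) (‖x‖⁻¹ • x) := by
    refine (contDiffOn_stereoToFun (n := 1)).differentiableOn one_ne_zero |>.differentiableAt
      (IsOpen.mem_nhds (isOpen_ne_fun (by fun_prop) continuous_const) ?_)
    have := hx.2
    simp only [Set.mem_ofPred_eq, innerSL_apply_apply, inner_smul_right] at this ⊢
    intro h
    rw [inv_mul_eq_one₀ hx0] at h
    exact this.ne h.symm
  refine hasFDerivAt_primitive_of_leftInverse (F := F) ?_ (hF.differentiable (by norm_num) _) ?_
    (hw _ ⟨hx.1, trivial⟩)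
  · exact hnorm.prodMk (DifferentiableAt.comp (f := fun y ↦ ‖y‖⁻¹ • y) x hst
      ((hnorm.fun_inv hx0).fun_smul differentiableAt_fun_id))
  · filter_upwards [hopen.mem_nhds hx] with y hy using hFG y hy

theorem exists_primitive_openShell [FiniteDimensional ℝ E] (hE : 2 < Module.finrank ℝ E)
    {a b : ℝ} (ha : 0 ≤ a)
    {ω : E → E →L[ℝ] ℝ} (hω : DifferentiableOn ℝ ω (openShell E a b))
    (hsymm : ∀ x ∈ openShell E a b, ∀ y z, fderiv ℝ ω x y z = fderiv ℝ ω x z y) :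
    ∃ u : E → ℝ, ∀ x ∈ openShell E a b, HasFDerivAt u (ω x) x := by
  have : Nontrivial E := Module.nontrivial_of_finrank_pos (R := ℝ) (by lia)
  obtain ⟨v, hv⟩ := exists_norm_eq E zero_le_one
  have hopen : ∀ v : E, IsOpen (openShell E a b ∩ {x | inner ℝ v x < ‖x‖}) := fun v ↦
    (isOpen_openShell a b).inter (isOpen_lt (by fun_prop) continuous_norm)
  have hline : ∀ x : E, x ∈ (ℝ ∙ v) ↔ ¬ (inner ℝ v x < ‖x‖ ∧ inner ℝ (-v) x < ‖x‖) := by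
    intro x
    have hle := abs_real_inner_le_norm v x
    rw [hv, one_mul, abs_le] at hle
    constructor
    · rintro h ⟨h1, h2⟩
      obtain ⟨c, rfl⟩ := Submodule.mem_span_singleton.1 h
      simp only [inner_smul_right, inner_neg_left, real_inner_self_eq_norm_sq, hv, norm_smul,
        Real.norm_eq_abs] at h1 h2
      rcases abs_cases c with h | h <;> linarith
    · intro h
      rw [not_and_or, not_lt, not_lt, inner_neg_left] at h
      have habs : ‖inner ℝ v x‖ = ‖v‖ * ‖x‖ := by
        rw [hv, one_mul, Real.norm_eq_abs]
        rcases h with h | h <;> rcases abs_cases (inner ℝ v x) with h' | h' <;> linarith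
      have hv0 : v ≠ 0 := by rintro rfl; simp at hv
      have h3 := (norm_inner_eq_norm_tfae ℝ v x).out 0 3
      rcases h3.1 habs with h4 | h4
      · exact absurd h4 hv0
      · exact h4
  have hcodim : 1 < Module.rank ℝ (E ⧸ (ℝ ∙ v)) := by
    have h1 := (ℝ ∙ v).finrank_quotient_add_finrank
    have h2 := finrank_span_singleton (K := ℝ) (v := v) (by rintro rfl; simp at hv)
    rw [← Module.finrank_eq_rank]
    exact_mod_cast (by lia : 1 < Module.finrank ℝ (E ⧸ (ℝ ∙ v)))
  have hconn : IsPreconnected ((((ℝ ∙ v : Submodule ℝ E) : Set E)ᶜ) ∩ openShell E a b) :=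
    (isConnected_compl_of_one_lt_codim hcodim).isPreconnected.inter_openShell (by simp)
      (fun x hx s hs h ↦ hx (by
        have := (ℝ ∙ v).smul_mem s⁻¹ h
        rwa [inv_smul_smul₀ hs.ne'] at this)) ha
  have hinter : openShell E a b ∩ {x | inner ℝ v x < ‖x‖} ∩
      (openShell E a b ∩ {x | inner ℝ (-v) x < ‖x‖}) =
      ((ℝ ∙ v : Submodule ℝ E) : Set E)ᶜ ∩ openShell E a b := by
    ext x
    simp only [Set.mem_inter_iff, Set.mem_ofPred_eq, Set.mem_compl_iff, SetLike.mem_coe, hline x]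
    tauto
  obtain ⟨u, hu⟩ := exists_primitive_union (hopen v) (hopen (-v)) (hinter ▸ hconn)
    (exists_primitive_openShell_inner_lt hv ha hω hsymm)
    (exists_primitive_openShell_inner_lt (by rwa [norm_neg]) ha hω hsymm)
  refine ⟨u, fun x hx ↦ hu x ?_⟩
  have hx0 : 0 < ‖x‖ := ha.trans_lt hx.1
  rcases lt_or_ge (inner ℝ v x) ‖x‖ with h | h
  · exact Or.inl ⟨hx, h⟩
  · refine Or.inr ⟨hx, ?_⟩
    rw [Set.mem_ofPred_eq, inner_neg_left]
    linarith

end Shell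

section Oscillation

open scoped NNReal ENNReal

variable {E : Type*} [NormedAddCommGroup E] [NormedSpace ℝ E] [FiniteDimensional ℝ E]
  [MeasurableSpace E] [BorelSpace E] {ν : Measure E} [ν.IsAddHaarMeasure]

theorem lintegral_comp_smul_add_le {G : E → ℝ≥0∞} (hG : Measurable G) {s : ℝ} (hs : 1 / 2 ≤ s)
    (c : E) : ∫⁻ x, G (s • x + c) ∂ν ≤ 2 ^ Module.finrank ℝ E * ∫⁻ x, G x ∂ν := by
  have hs0 : 0 < s := by linarith
  calc ∫⁻ x, G (s • x + c) ∂ν = ∫⁻ x, G (s • (x + s⁻¹ • c)) ∂ν := by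
        simp [smul_add, smul_inv_smul₀ hs0.ne']
    _ = ∫⁻ x, G (s • x) ∂ν := lintegral_add_right_eq_self (fun x ↦ G (s • x)) _
    _ = ∫⁻ x, G x ∂(ν.map (s • ·)) := (lintegral_map hG (measurable_const_smul s)).symm
    _ = ENNReal.ofReal |(s ^ Module.finrank ℝ E)⁻¹| * ∫⁻ x, G x ∂ν := by
        rw [Measure.map_addHaar_smul ν hs0.ne', lintegral_smul_measure, smul_eq_mul]
    _ ≤ 2 ^ Module.finrank ℝ E * ∫⁻ x, G x ∂ν := by
        gcongr
        rw [abs_of_nonneg (by positivity), ← inv_pow, ENNReal.ofReal_pow (by positivity)]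
        gcongr
        rw [← ENNReal.ofReal_ofNat 2]
        refine ENNReal.ofReal_le_ofReal ?_
        rw [inv_le_comm₀ hs0 (by norm_num)]
        linarith

theorem setLIntegral_setLIntegral_comp_lineMap_le {G : E → ℝ≥0∞} (hG : Measurable G) (B : Set E)
    (t : ℝ) :
    ∫⁻ y in B, ∫⁻ x in B, G ((1 - t) • x + t • y) ∂ν ∂ν ≤
      2 ^ Module.finrank ℝ E * (∫⁻ x, G x ∂ν) * ν B := by
  have key : ∀ s r : ℝ, 1 / 2 ≤ s → ∫⁻ y in B, ∫⁻ x in B, G (s • x + r • y) ∂ν ∂ν ≤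
      2 ^ Module.finrank ℝ E * (∫⁻ x, G x ∂ν) * ν B := fun s r hs ↦
    calc ∫⁻ y in B, ∫⁻ x in B, G (s • x + r • y) ∂ν ∂ν
        ≤ ∫⁻ y in B, 2 ^ Module.finrank ℝ E * (∫⁻ x, G x ∂ν) ∂ν :=
          lintegral_mono fun y ↦ (setLIntegral_le_lintegral _ _).trans
            (lintegral_comp_smul_add_le hG hs _)
      _ = _ := by rw [setLIntegral_const]
  rcases le_total t (1 / 2) with ht | ht
  · exact key _ _ (by linarith)
  · rw [lintegral_lintegral_swap]
    · simpa only [add_comm] using key t (1 - t) ht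
    · exact (hG.comp (by fun_prop)).aemeasurable

omit [FiniteDimensional ℝ E] [MeasurableSpace E] [BorelSpace E] in
theorem enorm_sub_le_lintegral_segment {S B : Set E} (hB : Convex ℝ B) (hBS : B ⊆ S)
    {D : ℝ≥0} (hD : ∀ x ∈ B, ∀ y ∈ B, ‖y - x‖ₑ ≤ D) {u : E → ℝ} {ω : E → E →L[ℝ] ℝ}
    (hω : ContinuousOn ω S) (hu : ∀ x ∈ S, HasFDerivAt u (ω x) x) {x y : E} (hx : x ∈ B)
    (hy : y ∈ B) :
    ‖u x - u y‖ₑ ≤ D * ∫⁻ t in Set.Icc (0 : ℝ) 1,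
      B.indicator (fun z ↦ ‖ω z‖ₑ) ((1 - t) • x + t • y) := by
  have hmem : ∀ t ∈ Set.Icc (0 : ℝ) 1, (1 - t) • x + t • y ∈ B := fun t ht ↦
    hB hx hy (by linarith [ht.2]) ht.1 (by ring)
  have hγ : ∀ t : ℝ, HasDerivAt (fun t : ℝ ↦ (1 - t) • x + t • y) (y - x) t := fun t ↦ by
    have h1 := (((hasDerivAt_id t).const_sub 1).smul_const x).fun_add ((hasDerivAt_id t).smul_const y)
    simpa only [neg_smul, one_smul, neg_add_eq_sub, id_eq] using h1
  have hderiv : ∀ t ∈ Set.uIcc (0 : ℝ) 1, HasDerivAt (fun t : ℝ ↦ u ((1 - t) • x + t • y))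
      (ω ((1 - t) • x + t • y) (y - x)) t := fun t ht ↦ by
    rw [Set.uIcc_of_le zero_le_one] at ht
    exact (hu _ (hBS (hmem t ht))).comp_hasDerivAt t (hγ t)
  have hcont : ContinuousOn (fun t : ℝ ↦ ω ((1 - t) • x + t • y) (y - x)) (Set.uIcc 0 1) := by
    rw [Set.uIcc_of_le zero_le_one]
    exact (hω.comp (by fun_prop) fun t ht ↦ hBS (hmem t ht)).clm_apply continuousOn_const
  have hftc := intervalIntegral.integral_eq_sub_of_hasDerivAt hderiv hcont.intervalIntegrable
  simp only [sub_zero, one_smul, zero_smul, add_zero, sub_self, zero_add] at hftc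
  rw [← enorm_neg, neg_sub, ← hftc, intervalIntegral.integral_of_le zero_le_one,
    ← integral_Icc_eq_integral_Ioc, ← lintegral_const_mul' _ _ ENNReal.coe_ne_top]
  refine (enorm_integral_le_lintegral_enorm _).trans (setLIntegral_mono' measurableSet_Icc ?_)
  intro t ht
  rw [Set.indicator_of_mem (hmem t ht), mul_comm]
  exact (ContinuousLinearMap.le_opENorm _ _).trans (by gcongr; exact hD x hx y hy)

/-- The mean oscillation between `V` and `W` of a function on `S` is controlled by the `L¹` norm
of its derivative on `S`. -/
def OscillationBound (ν : Measure E) (S V W : Set E) : Prop :=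
  ∃ C : ℝ≥0, ∀ (u : E → ℝ) (ω : E → E →L[ℝ] ℝ), Measurable u → ContinuousOn ω S →
    (∀ x ∈ S, HasFDerivAt u (ω x) x) →
      ∫⁻ y in W, ∫⁻ x in V, ‖u x - u y‖ₑ ∂ν ∂ν ≤ C * ∫⁻ x in S, ‖ω x‖ₑ ∂ν

theorem Convex.oscillationBound {S B : Set E} (hB : Convex ℝ B) (hBo : IsOpen B)
    (hBb : Bornology.IsBounded B) (hBS : B ⊆ S) : OscillationBound ν S B B := by
  obtain ⟨D, hD⟩ : ∃ D : ℝ≥0, ∀ x ∈ B, ∀ y ∈ B, ‖y - x‖ₑ ≤ D := by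
    obtain ⟨D, hD⟩ := Metric.isBounded_iff.1 hBb
    refine ⟨D.toNNReal, fun x hx y hy ↦ ?_⟩
    rw [← ofReal_norm, ← dist_eq_norm]
    exact ENNReal.ofReal_le_ofReal (hD hy hx)
  have hνB : ν B ≠ ∞ := hBb.measure_lt_top.ne
  refine ⟨D * (2 ^ Module.finrank ℝ E * (ν B).toNNReal), fun u ω _ hω hu ↦ ?_⟩
  set G : E → ℝ≥0∞ := B.indicator fun z ↦ ‖ω z‖ₑ with hGdef
  have hG : Measurable G := by
    classical
    rw [hGdef, ← Set.piecewise_eq_indicator]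
    exact (hω.mono hBS).enorm.measurable_piecewise continuousOn_const hBo.measurableSet
  have hGint : ∫⁻ x, G x ∂ν ≤ ∫⁻ x in S, ‖ω x‖ₑ ∂ν := by
    rw [hGdef, lintegral_indicator hBo.measurableSet]
    exact lintegral_mono_set hBS
  calc ∫⁻ y in B, ∫⁻ x in B, ‖u x - u y‖ₑ ∂ν ∂ν
      ≤ ∫⁻ y in B, ∫⁻ x in B, D * (∫⁻ t in Set.Icc (0 : ℝ) 1, G ((1 - t) • x + t • y)) ∂ν ∂ν :=
        setLIntegral_mono' hBo.measurableSet fun y hy ↦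
          setLIntegral_mono' hBo.measurableSet fun x hx ↦
            enorm_sub_le_lintegral_segment hB hBS hD hω hu hx hy
    _ = D * ∫⁻ y in B, ∫⁻ x in B, (∫⁻ t in Set.Icc (0 : ℝ) 1, G ((1 - t) • x + t • y)) ∂ν ∂ν := by
        simp_rw [lintegral_const_mul' _ _ ENNReal.coe_ne_top]
    _ = D * ∫⁻ t in Set.Icc (0 : ℝ) 1, (∫⁻ y in B, ∫⁻ x in B, G ((1 - t) • x + t • y) ∂ν ∂ν) := by
        congr 1
        have h1 : ∀ y, ∫⁻ x in B, (∫⁻ t in Set.Icc (0 : ℝ) 1, G ((1 - t) • x + t • y)) ∂ν =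
            ∫⁻ t in Set.Icc (0 : ℝ) 1, ∫⁻ x in B, G ((1 - t) • x + t • y) ∂ν := fun y ↦
          lintegral_lintegral_swap (f := fun x t ↦ G ((1 - t) • x + t • y))
            (hG.comp (by fun_prop)).aemeasurable
        simp_rw [h1]
        refine lintegral_lintegral_swap (Measurable.aemeasurable ?_)
        exact Measurable.lintegral_prod_right'
          (f := fun p : (E × ℝ) × E ↦ G ((1 - p.1.2) • p.2 + p.1.2 • p.1.1))
          (hG.comp (by fun_prop))
    _ ≤ D * ∫⁻ t in Set.Icc (0 : ℝ) 1, 2 ^ Module.finrank ℝ E * (∫⁻ x, G x ∂ν) * ν B := by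
        gcongr
        exact setLIntegral_setLIntegral_comp_lineMap_le hG B _
    _ = D * (2 ^ Module.finrank ℝ E * ν B) * ∫⁻ x, G x ∂ν := by
        rw [setLIntegral_const, Real.volume_Icc]
        simp
        ring
    _ ≤ _ := by
        rw [ENNReal.coe_mul, ENNReal.coe_mul, ENNReal.coe_toNNReal hνB]
        push_cast
        gcongr

omit [FiniteDimensional ℝ E] [BorelSpace E] [ν.IsAddHaarMeasure] in
theorem OscillationBound.mono {S V V' W W' : Set E} (h : OscillationBound ν S V W)
    (hV : V' ⊆ V) (hW : W' ⊆ W) : OscillationBound ν S V' W' := by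
  obtain ⟨C, hC⟩ := h
  refine ⟨C, fun u ω hum hω hu ↦ le_trans ?_ (hC u ω hum hω hu)⟩
  exact (lintegral_mono_set hW).trans (lintegral_mono fun y ↦ lintegral_mono_set hV)

omit [BorelSpace E] in
theorem OscillationBound.union {S V V' W : Set E} (h : OscillationBound ν S V W)
    (h' : OscillationBound ν S V' W) : OscillationBound ν S (V ∪ V') W := by
  obtain ⟨C, hC⟩ := h
  obtain ⟨C', hC'⟩ := h'
  refine ⟨C + C', fun u ω hum hω hu ↦ ?_⟩
  rw [ENNReal.coe_add, add_mul]
  refine le_trans ?_ (add_le_add (hC u ω hum hω hu) (hC' u ω hum hω hu))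
  rw [← lintegral_add_left]
  · exact lintegral_mono fun y ↦ lintegral_union_le _ _ _
  · exact Measurable.lintegral_prod_right' (f := fun p : E × E ↦ ‖u p.2 - u p.1‖ₑ) (by fun_prop)

omit [BorelSpace E] in
theorem OscillationBound.trans {S V W Z : Set E} (h : OscillationBound ν S V W)
    (h' : OscillationBound ν S W Z) (hV : ν V ≠ ∞) (hW0 : ν W ≠ 0) (hW : ν W ≠ ∞)
    (hZ : ν Z ≠ ∞) : OscillationBound ν S V Z := by
  obtain ⟨C, hC⟩ := h
  obtain ⟨C', hC'⟩ := h'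
  refine ⟨(ν W).toNNReal⁻¹ * ((ν Z).toNNReal * C + (ν V).toNNReal * C'), fun u ω hum hω hu ↦ ?_⟩
  have hm : ∀ T : Set E, Measurable fun y ↦ ∫⁻ x in T, ‖u x - u y‖ₑ ∂ν := fun T ↦
    Measurable.lintegral_prod_right' (f := fun p : E × E ↦ ‖u p.2 - u p.1‖ₑ) (by fun_prop)
  have hW0' : (ν W).toNNReal ≠ 0 := ENNReal.toNNReal_ne_zero.2 ⟨hW0, hW⟩
  rw [ENNReal.coe_mul, ENNReal.coe_inv hW0', ENNReal.coe_toNNReal hW, mul_assoc, mul_comm (ν W)⁻¹,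
    ← div_eq_mul_inv, ENNReal.le_div_iff_mul_le (Or.inl hW0) (Or.inl hW), mul_comm]
  push_cast
  rw [ENNReal.coe_toNNReal hV, ENNReal.coe_toNNReal hZ, add_mul, mul_assoc, mul_assoc]
  have hpt : ∀ z, ν W * ∫⁻ x in V, ‖u x - u z‖ₑ ∂ν ≤
      (∫⁻ y in W, ∫⁻ x in V, ‖u x - u y‖ₑ ∂ν ∂ν) + ν V * ∫⁻ y in W, ‖u y - u z‖ₑ ∂ν := by
    intro z
    calc ν W * ∫⁻ x in V, ‖u x - u z‖ₑ ∂ν = ∫⁻ y in W, ∫⁻ x in V, ‖u x - u z‖ₑ ∂ν ∂ν := by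
          rw [setLIntegral_const, mul_comm]
      _ ≤ ∫⁻ y in W, ∫⁻ x in V, ‖u x - u y‖ₑ + ‖u y - u z‖ₑ ∂ν ∂ν := by
          gcongr with y x
          rw [← sub_add_sub_cancel (u x) (u y) (u z)]
          exact enorm_add_le _ _
      _ = _ := by
          simp_rw [lintegral_add_right _ measurable_const, setLIntegral_const]
          rw [lintegral_add_left (hm V), lintegral_mul_const' _ _ hV, mul_comm (ν V)]
  calc ν W * ∫⁻ z in Z, ∫⁻ x in V, ‖u x - u z‖ₑ ∂ν ∂ν
      = ∫⁻ z in Z, ν W * ∫⁻ x in V, ‖u x - u z‖ₑ ∂ν ∂ν := (lintegral_const_mul' _ _ hW).symm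
    _ ≤ ∫⁻ z in Z, ((∫⁻ y in W, ∫⁻ x in V, ‖u x - u y‖ₑ ∂ν ∂ν) +
          ν V * ∫⁻ y in W, ‖u y - u z‖ₑ ∂ν) ∂ν := lintegral_mono hpt
    _ = ν Z * (∫⁻ y in W, ∫⁻ x in V, ‖u x - u y‖ₑ ∂ν ∂ν) +
          ν V * ∫⁻ z in Z, ∫⁻ y in W, ‖u y - u z‖ₑ ∂ν ∂ν := by
        rw [lintegral_add_left measurable_const, setLIntegral_const, mul_comm (ν Z),
          lintegral_const_mul' _ _ hV]
    _ ≤ _ := by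
        gcongr
        · exact hC u ω hum hω hu
        · exact hC' u ω hum hω hu

theorem IsPreconnected.exists_oscillationBound {S : Set E} (hS : IsOpen S) (hSc : IsPreconnected S)
    {W : Set E} (hW : Convex ℝ W) (hWo : IsOpen W) (hWb : Bornology.IsBounded W)
    (hWne : W.Nonempty) (hWS : W ⊆ S) {x : E} (hx : x ∈ S) :
    ∃ V, IsOpen V ∧ x ∈ V ∧ ν V ≠ ∞ ∧ OscillationBound ν S V W := by
  let T : Set E := {x | ∃ V, IsOpen V ∧ x ∈ V ∧ ν V ≠ ∞ ∧ OscillationBound ν S V W}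
  have hνW : ν W ≠ ∞ := hWb.measure_lt_top.ne
  suffices S ⊆ T from this hx
  have hTo : IsOpen T := by
    refine isOpen_iff_mem_nhds.2 fun x ⟨V, hV, hxV, h⟩ ↦ ?_
    filter_upwards [hV.mem_nhds hxV] with y hy using ⟨V, hV, hy, h⟩
  obtain ⟨w, hw⟩ := hWne
  refine hSc.subset_of_closure_inter_subset hTo
    ⟨w, hWS hw, W, hWo, hw, hνW, hW.oscillationBound hWo hWb hWS⟩ ?_
  rintro x ⟨hxT, hxS⟩
  obtain ⟨ε, hε, hεS⟩ := Metric.isOpen_iff.1 hS x hxS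
  have hfin : ν (Metric.ball x ε) ≠ ∞ := Metric.isBounded_ball.measure_lt_top.ne
  obtain ⟨y, hyε, V, hV, hyV, hνV, hb⟩ := mem_closure_iff.1 hxT _ Metric.isOpen_ball
    (Metric.mem_ball_self hε)
  have hball : OscillationBound ν S (Metric.ball x ε) (Metric.ball x ε) :=
    (convex_ball x ε).oscillationBound Metric.isOpen_ball Metric.isBounded_ball hεS
  refine ⟨Metric.ball x ε, Metric.isOpen_ball, Metric.mem_ball_self hε, hfin, ?_⟩
  refine (hball.mono subset_rfl Set.inter_subset_left).trans
    (hb.mono Set.inter_subset_right subset_rfl) (W := Metric.ball x ε ∩ V) hfin ?_ ?_ hνW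
  · exact ((Metric.isOpen_ball.inter hV).measure_pos ν ⟨y, hyε, hyV⟩).ne'
  · exact measure_ne_top_of_subset Set.inter_subset_left hfin

/-- `L¹`-Poincaré inequality on a compact subset of a connected open set. -/
theorem IsPreconnected.exists_lintegral_sub_const_le {S : Set E} (hS : IsOpen S)
    (hSc : IsPreconnected S) {K : Set E} (hK : IsCompact K) (hKS : K ⊆ S) :
    ∃ C : ℝ≥0, ∀ (u : E → ℝ) (ω : E → E →L[ℝ] ℝ), Measurable u → ContinuousOn ω S →
      (∀ x ∈ S, HasFDerivAt u (ω x) x) →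
        ∃ c : ℝ, ∫⁻ x in K, ‖u x - c‖ₑ ∂ν ≤ C * ∫⁻ x in S, ‖ω x‖ₑ ∂ν := by
  rcases K.eq_empty_or_nonempty with rfl | ⟨x₀, hx₀⟩
  · exact ⟨0, fun u ω _ _ _ ↦ ⟨0, by simp⟩⟩
  obtain ⟨ε, hε, hεS⟩ := Metric.isOpen_iff.1 hS x₀ (hKS hx₀)
  set W := Metric.ball x₀ ε
  have hW0 : ν W ≠ 0 := (Metric.measure_ball_pos ν x₀ hε).ne'
  have hW : ν W ≠ ∞ := Metric.isBounded_ball.measure_lt_top.ne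
  have hKW : OscillationBound ν S K W := by
    refine hK.induction_on (p := fun K ↦ OscillationBound ν S K W) ⟨0, by simp⟩
      (fun s t hst h ↦ h.mono hst subset_rfl) (fun s t h h' ↦ h.union h') fun x hx ↦ ?_
    obtain ⟨V, hV, hxV, -, h⟩ := hSc.exists_oscillationBound (ν := ν) hS (convex_ball x₀ ε)
      Metric.isOpen_ball Metric.isBounded_ball ⟨x₀, Metric.mem_ball_self hε⟩ hεS (hKS hx)
    exact ⟨V, mem_nhdsWithin_of_mem_nhds (hV.mem_nhds hxV), h⟩
  obtain ⟨C, hC⟩ := hKW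
  refine ⟨(ν W).toNNReal⁻¹ * C, fun u ω hum hω hu ↦ ?_⟩
  obtain ⟨y, -, hy⟩ := exists_le_setLAverage hW0 hW (f := fun y ↦ ∫⁻ x in K, ‖u x - u y‖ₑ ∂ν)
    (Measurable.lintegral_prod_right' (f := fun p : E × E ↦ ‖u p.2 - u p.1‖ₑ)
      (by fun_prop)).aemeasurable
  refine ⟨u y, hy.trans ?_⟩
  rw [setLAverage_eq, ENNReal.div_eq_inv_mul, ENNReal.coe_mul,
    ENNReal.coe_inv (ENNReal.toNNReal_ne_zero.2 ⟨hW0, hW⟩), ENNReal.coe_toNNReal hW, mul_assoc]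
  gcongr
  exact hC u ω hum hω hu

end Oscillation

section ScaledShell

open scoped NNReal ENNReal

variable {E : Type*} [NormedAddCommGroup E] [InnerProductSpace ℝ E]

/-- The `1`-form dual to the vector field `X`, as a continuous linear function of the vector. -/
noncomputable def innerForm (E : Type*) [NormedAddCommGroup E] [InnerProductSpace ℝ E] :
    E →L[ℝ] E →L[ℝ] ℝ :=
  (isBoundedBilinearMap_inner (𝕜 := ℝ) (E := E)).toContinuousLinearMap

@[simp]
theorem innerForm_apply (x y : E) : innerForm E x y = inner ℝ x y := rfl

theorem enorm_innerForm (x : E) : ‖innerForm E x‖ₑ = ‖x‖ₑ := by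
  have h : innerForm E x = innerSL ℝ x := by ext; simp
  rw [h, ← ofReal_norm, innerSL_apply_norm, ofReal_norm]

variable [FiniteDimensional ℝ E] [MeasurableSpace E] [BorelSpace E]
  {ν : Measure E} [ν.IsAddHaarMeasure]

theorem exists_gradient_primitive_openShell_lintegral_le (hE : 2 < Module.finrank ℝ E)
    {a b a' b' : ℝ} (ha : 0 ≤ a) (haa' : a < a') (hbb' : b' < b) :
    ∃ C : ℝ≥0, ∀ X : E → E, DifferentiableOn ℝ X (openShell E a b) →
      (∀ x ∈ openShell E a b, ∀ y z,
        inner ℝ (fderiv ℝ X x y) z = inner ℝ (fderiv ℝ X x z) y) →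
      ∃ u : E → ℝ, (∀ x ∈ openShell E a b, HasFDerivAt u (innerForm E (X x)) x) ∧
        ∫⁻ x in openShell E a' b', ‖u x‖ₑ ∂ν ≤ C * ∫⁻ x in openShell E a b, ‖X x‖ₑ ∂ν := by
  have hS := isOpen_openShell (E := E) a b
  have hK : IsCompact {x : E | a' ≤ ‖x‖ ∧ ‖x‖ ≤ b'} := by
    refine (isCompact_closedBall (0 : E) b').of_isClosed_subset
      ((isClosed_le continuous_const continuous_norm).inter
        (isClosed_le continuous_norm continuous_const)) fun x hx ↦ ?_
    simpa using hx.2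
  have hrank : 1 < Module.rank ℝ E := by
    rw [← Module.finrank_eq_rank]
    exact_mod_cast (by lia : 1 < Module.finrank ℝ E)
  obtain ⟨C, hC⟩ := (isPreconnected_openShell hrank ha).exists_lintegral_sub_const_le (ν := ν) hS hK
    (fun x hx ↦ ⟨haa'.trans_le hx.1, hx.2.trans_lt hbb'⟩)
  refine ⟨C, fun X hX hsymm ↦ ?_⟩
  have hder : ∀ x ∈ openShell E a b, HasFDerivAt (fun x ↦ innerForm E (X x))
      ((innerForm E).comp (fderiv ℝ X x)) x := fun x hx ↦
    (innerForm E).hasFDerivAt.comp x (hX.differentiableAt (hS.mem_nhds hx)).hasFDerivAt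
  obtain ⟨v, hv⟩ := exists_primitive_openShell hE ha (ω := fun x ↦ innerForm E (X x))
    (fun x hx ↦ (hder x hx).differentiableAt.differentiableWithinAt)
    (fun x hx y z ↦ by simpa [(hder x hx).fderiv] using hsymm x hx y z)
  set w := (openShell E a b).indicator v with hw_def
  have hw : ∀ x ∈ openShell E a b, HasFDerivAt w (innerForm E (X x)) x := fun x hx ↦ by
    refine (hv x hx).congr_of_eventuallyEq ?_
    filter_upwards [hS.mem_nhds hx] with y hy
    simp [w, hy]
  have hwm : Measurable w := by
    classical
    rw [hw_def, ← Set.piecewise_eq_indicator]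
    exact ContinuousOn.measurable_piecewise
      (fun x hx ↦ (hv x hx).continuousAt.continuousWithinAt) continuousOn_const hS.measurableSet
  obtain ⟨c, hc⟩ := hC w (fun x ↦ innerForm E (X x)) hwm
    (fun x hx ↦ (hder x hx).continuousAt.continuousWithinAt) hw
  refine ⟨fun x ↦ w x - c, fun x hx ↦ (hw x hx).sub_const c, ?_⟩
  simp only [enorm_innerForm] at hc
  have hsub : openShell E a' b' ⊆ {x : E | a' ≤ ‖x‖ ∧ ‖x‖ ≤ b'} := fun x hx ↦
    ⟨hx.1.le, hx.2.le⟩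
  exact (lintegral_mono_set hsub).trans hc

omit [InnerProductSpace ℝ E] [FiniteDimensional ℝ E] [MeasurableSpace E] [BorelSpace E] in
theorem smul_mem_openShell_iff [NormedSpace ℝ E] {a b R : ℝ} (hR : 0 < R) {x : E} :
    R • x ∈ openShell E (a * R) (b * R) ↔ x ∈ openShell E a b := by
  simp only [openShell, Set.mem_ofPred_eq, norm_smul, Real.norm_of_nonneg hR.le, mul_comm R,
    mul_lt_mul_iff_left₀ hR]

theorem setLIntegral_openShell_comp_smul {a b R : ℝ} (hR : 0 < R) (f : E → ℝ≥0∞) :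
    ∫⁻ x in openShell E a b, f (R • x) ∂ν = ENNReal.ofReal |(R ^ Module.finrank ℝ E)⁻¹| *
      ∫⁻ x in openShell E (a * R) (b * R), f x ∂ν := by
  have hS : ∀ a b : ℝ, MeasurableSet (openShell E a b) := fun a b ↦
    (isOpen_openShell a b).measurableSet
  let e : E ≃ᵐ E := (Homeomorph.smulOfNeZero R hR.ne').toMeasurableEquiv
  have h1 : ∀ x, (openShell E a b).indicator (fun x ↦ f (R • x)) x =
      (openShell E (a * R) (b * R)).indicator f (e x) := fun x ↦ by
    change _ = (openShell E (a * R) (b * R)).indicator f (R • x)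
    by_cases hx : x ∈ openShell E a b
    · rw [Set.indicator_of_mem hx, Set.indicator_of_mem ((smul_mem_openShell_iff hR).2 hx)]
    · rw [Set.indicator_of_notMem hx,
        Set.indicator_of_notMem (mt (smul_mem_openShell_iff hR).1 hx)]
  rw [← lintegral_indicator (hS _ _), ← lintegral_indicator (hS _ _), lintegral_congr h1,
    ← lintegral_map_equiv]
  change ∫⁻ x, _ ∂(ν.map (R • ·)) = _
  rw [Measure.map_addHaar_smul ν hR.ne', lintegral_smul_measure, smul_eq_mul]

theorem exists_gradient_primitive_openShell_mul_lintegral_le (hE : 2 < Module.finrank ℝ E)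
    {a b a' b' : ℝ} (ha : 0 ≤ a) (haa' : a < a') (hbb' : b' < b) :
    ∃ C : ℝ≥0, ∀ R > 0, ∀ X : E → E, DifferentiableOn ℝ X (openShell E (a * R) (b * R)) →
      (∀ x ∈ openShell E (a * R) (b * R), ∀ y z,
        inner ℝ (fderiv ℝ X x y) z = inner ℝ (fderiv ℝ X x z) y) →
      ∃ u : E → ℝ, (∀ x ∈ openShell E (a * R) (b * R), HasFDerivAt u (innerForm E (X x)) x) ∧
        ∫⁻ x in openShell E (a' * R) (b' * R), ‖u x‖ₑ ∂ν ≤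
          C * ENNReal.ofReal R * ∫⁻ x in openShell E (a * R) (b * R), ‖X x‖ₑ ∂ν := by
  obtain ⟨C, hC⟩ := exists_gradient_primitive_openShell_lintegral_le (ν := ν) hE ha haa' hbb'
  refine ⟨C, fun R hR X hX hsymm ↦ ?_⟩
  have hmem : ∀ x ∈ openShell E a b, R • x ∈ openShell E (a * R) (b * R) := fun x hx ↦
    (smul_mem_openShell_iff hR).2 hx
  have hsmul : ∀ (r : ℝ) (x : E), HasFDerivAt (fun y : E ↦ r • y)
      (r • ContinuousLinearMap.id ℝ E) x := fun r x ↦ (hasFDerivAt_id x).const_smul r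
  have hY : ∀ x ∈ openShell E a b, HasFDerivAt (fun x ↦ X (R • x))
      ((fderiv ℝ X (R • x)).comp (R • ContinuousLinearMap.id ℝ E)) x := fun x hx ↦
    HasFDerivAt.comp x (hX.differentiableAt
      ((isOpen_openShell _ _).mem_nhds (hmem x hx))).hasFDerivAt (hsmul R x)
  obtain ⟨u, hu, hle⟩ := hC (fun x ↦ X (R • x))
    (fun x hx ↦ (hY x hx).differentiableAt.differentiableWithinAt) (fun x hx y z ↦ by
      rw [(hY x hx).fderiv]
      simp [inner_smul_left, hsymm _ (hmem x hx) y z])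
  refine ⟨fun x ↦ R * u (R⁻¹ • x), fun x hx ↦ ?_, ?_⟩
  · have hx' : R⁻¹ • x ∈ openShell E a b := by
      rw [← smul_mem_openShell_iff hR, smul_inv_smul₀ hR.ne']
      exact hx
    have h := ((hu _ hx').comp x (hsmul R⁻¹ x)).const_mul R
    have hscale : R • (innerForm E (X x)).comp (R⁻¹ • ContinuousLinearMap.id ℝ E) =
        innerForm E (X x) := by
      ext y
      simp [hR.ne']
    rw [smul_inv_smul₀ hR.ne', hscale] at h
    exact h
  · set c := ENNReal.ofReal |(R ^ Module.finrank ℝ E)⁻¹| with hc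
    have hc0 : c ≠ 0 := by
      rw [hc, Ne, ENNReal.ofReal_eq_zero, not_le]
      positivity
    have h1 := setLIntegral_openShell_comp_smul (ν := ν) (a := a') (b := b') hR
      fun x ↦ ‖R * u (R⁻¹ • x)‖ₑ
    have h2 := setLIntegral_openShell_comp_smul (ν := ν) (a := a) (b := b) hR fun x ↦ ‖X x‖ₑ
    simp only [inv_smul_smul₀ hR.ne', enorm_mul] at h1
    rw [lintegral_const_mul' _ _ enorm_ne_top, Real.enorm_of_nonneg hR.le] at h1
    rw [h2] at hle
    rw [← ENNReal.mul_le_mul_iff_right hc0 ENNReal.ofReal_ne_top]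
    simp only [enorm_mul, Real.enorm_of_nonneg hR.le]
    rw [← h1]
    calc ENNReal.ofReal R * ∫⁻ x in openShell E a' b', ‖u x‖ₑ ∂ν
        ≤ ENNReal.ofReal R * (C * (c * ∫⁻ x in openShell E (a * R) (b * R), ‖X x‖ₑ ∂ν)) := by
          gcongr
      _ = _ := by ring

theorem inner_comm_of_apply_single_comm {ι : Type*} [Fintype ι] [DecidableEq ι]
    {L : EuclideanSpace ℝ ι →L[ℝ] EuclideanSpace ℝ ι}
    (hL : ∀ i j, L (EuclideanSpace.single j 1) i = L (EuclideanSpace.single i 1) j)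
    (y z : EuclideanSpace ℝ ι) : inner ℝ (L y) z = inner ℝ (L z) y := by
  set e := (EuclideanSpace.basisFun ι ℝ).toBasis
  let B := (innerForm (EuclideanSpace ℝ ι)).comp L
  have h1 : ∀ j z, B (EuclideanSpace.single j 1) z = B z (EuclideanSpace.single j 1) := by
    intro j z
    have : (B (EuclideanSpace.single j 1) : EuclideanSpace ℝ ι →ₗ[ℝ] ℝ) =
        (B.flip (EuclideanSpace.single j 1) : EuclideanSpace ℝ ι →ₗ[ℝ] ℝ) := by
      refine e.ext fun i ↦ ?_
      simpa [e, B, EuclideanSpace.inner_single_right] using hL i j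
    exact LinearMap.congr_fun this z
  have h2 : (B.flip z : EuclideanSpace ℝ ι →ₗ[ℝ] ℝ) = (B z : EuclideanSpace ℝ ι →ₗ[ℝ] ℝ) :=
    e.ext fun j ↦ by simpa [e] using h1 j z
  exact LinearMap.congr_fun h2 y

end ScaledShell

/-- Scaled `L¹`-Poincaré inequality on Euclidean shells: for `n ≥ 3` and radii
`0 < μ < 1 < λ < μ'` there is a constant `C > 0`, independent of `R`, such that
every `C¹` closed `1`-form `X` on `{μR < ‖x‖ < μ'R}`, integrable there, admits
a `C¹` primitive `u` on `A_R = {R < ‖x‖ < λR}` with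
`‖u‖_{L¹(A_R)} ≤ C · R · ‖X‖_{L¹({μR < ‖x‖ < μ'R})}`. -/
theorem scaled_shell_L1_poincare
    (n : ℕ) (hn : 3 ≤ n) (μ lam μ' : ℝ)
    (h0μ : 0 < μ) (hμ1 : μ < 1) (h1lam : 1 < lam) (hlamμ' : lam < μ') :
    ∃ C > (0 : ℝ), ∀ R > (0 : ℝ),
      ∀ X : EuclideanSpace ℝ (Fin n) → EuclideanSpace ℝ (Fin n),
      ContDiffOn ℝ 1 X {x | μ * R < ‖x‖ ∧ ‖x‖ < μ' * R} →
      IntegrableOn X {x | μ * R < ‖x‖ ∧ ‖x‖ < μ' * R} volume →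
      (∀ x ∈ {x : EuclideanSpace ℝ (Fin n) | μ * R < ‖x‖ ∧ ‖x‖ < μ' * R},
        ∀ i j : Fin n,
        fderivWithin ℝ X {x | μ * R < ‖x‖ ∧ ‖x‖ < μ' * R} x
            (EuclideanSpace.single j 1) i
          = fderivWithin ℝ X {x | μ * R < ‖x‖ ∧ ‖x‖ < μ' * R} x
              (EuclideanSpace.single i 1) j) →
      ∃ u : EuclideanSpace ℝ (Fin n) → ℝ,
        ContDiffOn ℝ 1 u {x | R < ‖x‖ ∧ ‖x‖ < lam * R} ∧
        (∀ x ∈ {x : EuclideanSpace ℝ (Fin n) | R < ‖x‖ ∧ ‖x‖ < lam * R},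
          ∀ i : Fin n,
          fderivWithin ℝ u {x | R < ‖x‖ ∧ ‖x‖ < lam * R} x
              (EuclideanSpace.single i 1) = X x i) ∧
        IntegrableOn u {x | R < ‖x‖ ∧ ‖x‖ < lam * R} volume ∧
        ∫ x in {x : EuclideanSpace ℝ (Fin n) | R < ‖x‖ ∧ ‖x‖ < lam * R}, |u x| ≤
          C * R *
            ∫ x in {x : EuclideanSpace ℝ (Fin n) | μ * R < ‖x‖ ∧ ‖x‖ < μ' * R},
              ‖X x‖ := by
  obtain ⟨C, hC⟩ := exists_gradient_primitive_openShell_mul_lintegral_le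
    (E := EuclideanSpace ℝ (Fin n)) (ν := volume) (by rw [finrank_euclideanSpace_fin]; lia)
    h0μ.le hμ1 hlamμ'
  refine ⟨C + 1, by positivity, fun R hR X hX hXi hsymm ↦ ?_⟩
  change ContDiffOn ℝ 1 X (openShell _ (μ * R) (μ' * R)) at hX
  change IntegrableOn X (openShell _ (μ * R) (μ' * R)) at hXi
  have hS := isOpen_openShell (E := EuclideanSpace ℝ (Fin n)) (μ * R) (μ' * R)
  have hA := isOpen_openShell (E := EuclideanSpace ℝ (Fin n)) R (lam * R)
  have hAS : openShell (EuclideanSpace ℝ (Fin n)) R (lam * R) ⊆ openShell _ (μ * R) (μ' * R) :=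
    fun x hx ↦ ⟨lt_of_le_of_lt (by nlinarith) hx.1, hx.2.trans (by gcongr)⟩
  obtain ⟨u, hu, hle⟩ := hC R hR X (hX.differentiableOn one_ne_zero) fun x hx ↦
    inner_comm_of_apply_single_comm fun i j ↦ by
      have h := hsymm x hx i j
      change fderivWithin ℝ X (openShell _ (μ * R) (μ' * R)) x _ i =
        fderivWithin ℝ X (openShell _ (μ * R) (μ' * R)) x _ j at h
      rwa [fderivWithin_of_isOpen hS hx] at h
  rw [one_mul] at hle
  have hfin : ∫⁻ x in openShell (EuclideanSpace ℝ (Fin n)) (μ * R) (μ' * R), ‖X x‖ₑ ≠ ⊤ :=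
    hXi.2.ne
  have hrhs := ENNReal.mul_ne_top (ENNReal.mul_ne_top (ENNReal.coe_ne_top (r := C))
    (ENNReal.ofReal_ne_top (r := R))) hfin
  have hcont : ContinuousOn u (openShell _ R (lam * R)) := fun x hx ↦
    (hu x (hAS hx)).continuousAt.continuousWithinAt
  have hui : IntegrableOn u (openShell _ R (lam * R)) :=
    ⟨hcont.aestronglyMeasurable hA.measurableSet, hle.trans_lt hrhs.lt_top⟩
  refine ⟨u, ?_, fun x hx i ↦ ?_, hui, ?_⟩
  · change ContDiffOn ℝ 1 u (openShell _ R (lam * R))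
    rw [show (1 : WithTop ℕ∞) = 0 + 1 by norm_num, contDiffOn_succ_iff_fderiv_of_isOpen hA]
    refine ⟨fun x hx ↦ (hu x (hAS hx)).differentiableAt.differentiableWithinAt, by simp, ?_⟩
    rw [contDiffOn_zero]
    exact ((innerForm _).continuous.comp_continuousOn (hX.continuousOn.mono hAS)).congr
      fun x hx ↦ (hu x (hAS hx)).fderiv
  · change fderivWithin ℝ u (openShell _ R (lam * R)) x _ = _
    rw [fderivWithin_of_isOpen hA hx, (hu x (hAS hx)).fderiv]
    simp [EuclideanSpace.inner_single_right]
  · change ∫ x in openShell _ R (lam * R), ‖u x‖ ≤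
      (C + 1) * R * ∫ x in openShell _ (μ * R) (μ' * R), ‖X x‖
    rw [integral_norm_eq_lintegral_enorm hui.1, integral_norm_eq_lintegral_enorm hXi.1]
    refine (ENNReal.toReal_mono hrhs hle).trans ?_
    rw [ENNReal.toReal_mul, ENNReal.toReal_mul, ENNReal.toReal_ofReal hR.le, ENNReal.coe_toReal]
    gcongr
    linarith
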